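/- arXiv:1304.7031 — 2 statements merged into one kernel-verified Lean document; each statement's English description precedes it below -/
import Mathlib

section
/- Conditional entropy power inequality for Gaussian states (Theorem 6.1): Let n, L₁, L₂ ≥ 1, let λ ∈ [0,1], and let M₁ (of size 2(n+L₁)) and M₂ (of size 2(n+L₂)) be valid quantum covariance matrices written in block form M₁ = [[A₁, K₁],[K₁ᵀ, B₁]] and M₂ = [[A₂, K₂],[K₂ᵀ, B₂]], where A₁, A₂ are the 2n×2n blocks of the system modes X₁, X₂ and B₁, B₂ are the 2L₁×2L₁ resp. 2L₂×2L₂ blocks of the auxiliary modes E₁, E₂. Define the matrix M_out of size 2(n+L₁+L₂) in block form with respect to (Y, E₁, E₂) by: Y-block λ·A₁ + (1−λ)·A₂, Y–E₁ block √λ·K₁, Y–E₂ block √(1−λ)·K₂, E₁-block B₁, E₂-block B₂, and E₁–E₂ block 0. Then M_out is again a valid quantum covariance matrix (in particular positive definite), and E(M_out) − E(B₁) − E(B₂) ≥ λ·(E(M₁) − E(B₁)) + (1−λ)·(E(M₂) − E(B₂)). -/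
open scoped Classical ComplexOrder

noncomputable section

/-- The function `g(x) = (x+1)·log(x+1) − x·log x` (with `g 0 = 0` since `log 0 = 0`). -/
def gFn (x : ℝ) : ℝ := (x + 1) * Real.log (x + 1) - x * Real.log x

/-- Single-mode entropy as a function of the symplectic eigenvalue: `G(λ) = g((λ−1)/2)`. -/
def GFn (lam : ℝ) : ℝ := gFn ((lam - 1) / 2)

/-- Inverse temperature `β(λ) = log((λ+1)/(λ−1))`. -/
def betaFn (lam : ℝ) : ℝ := Real.log ((lam + 1) / (lam - 1))

/-- The standard symplectic form matrix on `ℝ^d` (for even `d = 2N` this is the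
block-diagonal matrix with `N` diagonal blocks `[[0,1],[-1,0]]`). -/
def Jmat (d : ℕ) : Matrix (Fin d) (Fin d) ℝ := fun i j =>
  if (i : ℕ) % 2 = 0 ∧ (j : ℕ) = (i : ℕ) + 1 then 1
  else if (j : ℕ) % 2 = 0 ∧ (i : ℕ) = (j : ℕ) + 1 then -1 else 0

/-- A real `d×d` matrix is symplectic if `S·J·Sᵀ = J`. -/
def IsSymplectic {d : ℕ} (S : Matrix (Fin d) (Fin d) ℝ) : Prop :=
  S * Jmat d * S.transpose = Jmat d

/-- The doubled diagonal matrix `D(λ) = diag(λ₀,λ₀,λ₁,λ₁,…)`. -/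
def Dmat (d : ℕ) (lam : ℕ → ℝ) : Matrix (Fin d) (Fin d) ℝ :=
  Matrix.diagonal fun i => lam ((i : ℕ) / 2)

/-- A valid quantum covariance matrix: `M` symmetric with `M + i·J ⪰ 0`. -/
def IsQCov {d : ℕ} (M : Matrix (Fin d) (Fin d) ℝ) : Prop :=
  M.IsSymm ∧
    (M.map (Complex.ofReal) + Complex.I • (Jmat d).map Complex.ofReal).PosSemidef

/-- Entropy functional `E(M) = Σⱼ G(λⱼ)` where `λⱼ` are the symplectic eigenvalues of `M`:
the eigenvalues of `i·J·M` are `±λⱼ`, so `E(M) = (1/2)·Σ_{μ root of charpoly} G(|Re μ|)`. -/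
def Ent {d : ℕ} (M : Matrix (Fin d) (Fin d) ℝ) : ℝ :=
  ((Matrix.charpoly (Complex.I • ((Jmat d * M).map Complex.ofReal))).roots.map
    fun μ => GFn |μ.re|).sum / 2

/-- The matrix `I_A ⊕ 0_B`: identity on the first `a` coordinates, zero on the rest. -/
def IA0B (d a : ℕ) : Matrix (Fin d) (Fin d) ℝ :=
  Matrix.diagonal fun i => if (i : ℕ) < a then 1 else 0

/-- Assemble a symmetric 2×2 block matrix `[[A, K], [Kᵀ, B]]`. -/
def assemble2 {a b : ℕ} (A : Matrix (Fin a) (Fin a) ℝ) (K : Matrix (Fin a) (Fin b) ℝ)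
    (B : Matrix (Fin b) (Fin b) ℝ) : Matrix (Fin (a + b)) (Fin (a + b)) ℝ := fun i j =>
  if hi : (i : ℕ) < a then
    if hj : (j : ℕ) < a then A ⟨i, hi⟩ ⟨j, hj⟩
    else K ⟨i, hi⟩ ⟨(j : ℕ) - a, by have := j.isLt; omega⟩
  else
    if hj : (j : ℕ) < a then K ⟨j, hj⟩ ⟨(i : ℕ) - a, by have := i.isLt; omega⟩
    else B ⟨(i : ℕ) - a, by have := i.isLt; omega⟩ ⟨(j : ℕ) - a, by have := j.isLt; omega⟩

/-- Assemble the symmetric 3×3 block matrix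
`[[Y, K₁, K₂], [K₁ᵀ, B₁, 0], [K₂ᵀ, 0, B₂]]`. -/
def assemble3 {a b c : ℕ} (Y : Matrix (Fin a) (Fin a) ℝ)
    (K₁ : Matrix (Fin a) (Fin b) ℝ) (K₂ : Matrix (Fin a) (Fin c) ℝ)
    (B₁ : Matrix (Fin b) (Fin b) ℝ) (B₂ : Matrix (Fin c) (Fin c) ℝ) :
    Matrix (Fin (a + b + c)) (Fin (a + b + c)) ℝ := fun i j =>
  if hi : (i : ℕ) < a then
    if hj : (j : ℕ) < a then Y ⟨i, hi⟩ ⟨j, hj⟩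
    else if hj' : (j : ℕ) < a + b then K₁ ⟨i, hi⟩ ⟨(j : ℕ) - a, by omega⟩
    else K₂ ⟨i, hi⟩ ⟨(j : ℕ) - a - b, by have := j.isLt; omega⟩
  else if hi' : (i : ℕ) < a + b then
    if hj : (j : ℕ) < a then K₁ ⟨j, hj⟩ ⟨(i : ℕ) - a, by omega⟩
    else if hj' : (j : ℕ) < a + b then
      B₁ ⟨(i : ℕ) - a, by omega⟩ ⟨(j : ℕ) - a, by omega⟩
    else 0
  else
    if hj : (j : ℕ) < a then K₂ ⟨j, hj⟩ ⟨(i : ℕ) - a - b, by have := i.isLt; omega⟩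
    else if hj' : (j : ℕ) < a + b then 0
    else B₂ ⟨(i : ℕ) - a - b, by have := i.isLt; omega⟩
      ⟨(j : ℕ) - a - b, by have := j.isLt; omega⟩


open scoped Matrix

/-- The complex matrix `M + i·x·J` attached to a real matrix `M` and a real parameter `x`. -/
def pencil {d : ℕ} (M : Matrix (Fin d) (Fin d) ℝ) (x : ℝ) : Matrix (Fin d) (Fin d) ℂ :=
  M.map Complex.ofReal + ((x : ℂ) * Complex.I) • (Jmat d).map Complex.ofReal

theorem Jmat_mul_Jmat {d : ℕ} (hd : Even d) : Jmat d * Jmat d = -1 := by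
  ext i j
  obtain ⟨k, rfl⟩ := hd
  have hi := i.isLt
  rw [Matrix.mul_apply]
  rcases Nat.even_or_odd (i : ℕ) with he | ho
  · have hm : (i : ℕ) % 2 = 0 := Nat.even_iff.mp he
    rw [Finset.sum_eq_single (⟨i + 1, by omega⟩ : Fin (k + k))]
    · by_cases hij : i = j
      · subst hij
        have h1 : ((i : ℕ) + 1) % 2 ≠ 0 := by omega
        simp [Jmat, hm, h1]
      · have hij' : (j : ℕ) ≠ i := fun h => hij (Fin.ext h.symm)
        have h1 : ((i : ℕ) + 1) % 2 ≠ 0 := by omega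
        simp [Jmat, hm, h1, hij]
        omega
    · intro b _ hb
      have hb' : (b : ℕ) ≠ i + 1 := fun h => hb (Fin.ext h)
      have h2 : ¬ ((b : ℕ) % 2 = 0 ∧ (i : ℕ) = b + 1) := by omega
      simp [Jmat, hb', h2]
    · simp
  · have hm : (i : ℕ) % 2 = 1 := Nat.odd_iff.mp ho
    rw [Finset.sum_eq_single (⟨i - 1, by omega⟩ : Fin (k + k))]
    · have h1 : ((i : ℕ) - 1) % 2 = 0 := by omega
      have h2 : (i : ℕ) = i - 1 + 1 := by omega
      by_cases hij : i = j
      · subst hij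
        simp [Jmat, hm, h1, ← h2]
      · have hij' : (j : ℕ) ≠ i := fun h => hij (Fin.ext h.symm)
        simp [Jmat, hm, h1, ← h2, hij, hij']
        omega
    · intro b _ hb
      have hb' : (i : ℕ) ≠ b + 1 := fun h => hb (Fin.ext (by simp; omega))
      simp [Jmat, hb', hm]
    · simp

theorem Jmat_transpose (d : ℕ) : (Jmat d).transpose = -Jmat d := by
  ext i j
  simp only [Matrix.transpose_apply, Matrix.neg_apply, Jmat]
  split_ifs <;> first | omega | simp

theorem Jmat_map_mul_self {d : ℕ} (hd : Even d) :
    (Jmat d).map Complex.ofReal * (Jmat d).map Complex.ofReal = -1 := by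
  have h := congrArg (fun X => X.map Complex.ofRealHom) (Jmat_mul_Jmat hd)
  simp only [Matrix.map_mul] at h
  rw [show (Jmat d).map Complex.ofReal = (Jmat d).map Complex.ofRealHom from rfl, h]
  ext i j
  by_cases hij : i = j <;> simp [hij]

theorem Jmat_map_conjTranspose (d : ℕ) :
    ((Jmat d).map Complex.ofReal).conjTranspose = -(Jmat d).map Complex.ofReal := by
  ext i j
  have h := congrFun (congrFun (Jmat_transpose d) i) j
  simp only [Matrix.transpose_apply, Matrix.neg_apply] at h
  simp [h]

theorem norm_det_I_smul_Jmat {d : ℕ} (hd : Even d) :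
    ‖(Complex.I • (Jmat d).map Complex.ofReal).det‖ = 1 := by
  have h : (Complex.I • (Jmat d).map Complex.ofReal) *
      (Complex.I • (Jmat d).map Complex.ofReal) = 1 := by
    rw [Matrix.smul_mul, Matrix.mul_smul, Jmat_map_mul_self hd, smul_smul]
    simp
  have h2 := congrArg (fun X : Matrix (Fin d) (Fin d) ℂ => ‖X.det‖) h
  simp only [Matrix.det_mul, norm_mul, Matrix.det_one, norm_one] at h2
  have h3 := norm_nonneg (Complex.I • (Jmat d).map Complex.ofReal).det
  exact (mul_self_eq_one_iff.mp h2).resolve_right (by linarith)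

theorem pencil_zero {d : ℕ} (M : Matrix (Fin d) (Fin d) ℝ) :
    pencil M 0 = M.map Complex.ofReal := by
  simp [pencil]

theorem isQCov_iff_pencil {d : ℕ} (M : Matrix (Fin d) (Fin d) ℝ) :
    IsQCov M ↔ (pencil M 1).PosSemidef := by
  have hp : pencil M 1 = M.map Complex.ofReal + Complex.I • (Jmat d).map Complex.ofReal := by
    simp [pencil]
  rw [IsQCov, ← hp]
  refine ⟨And.right, fun h => ⟨?_, h⟩⟩
  ext i j
  have h1 := congrArg Complex.re (h.isHermitian.apply i j)
  simpa [pencil] using h1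

theorem pencil_neg_one {d : ℕ} {M : Matrix (Fin d) (Fin d) ℝ} (hM : IsQCov M) :
    (pencil M (-1)).PosSemidef := by
  have h := ((isQCov_iff_pencil M).mp hM).transpose
  suffices e : pencil M (-1) = (pencil M 1).transpose by rwa [e]
  ext i j
  have h1 := congrFun (congrFun (Jmat_transpose d) i) j
  have h2 := hM.1.apply i j
  simp only [Matrix.transpose_apply, Matrix.neg_apply] at h1
  simp [pencil, h1, h2]

theorem pencil_posDef {d : ℕ} (hd : Even d) {M : Matrix (Fin d) (Fin d) ℝ} (hM : IsQCov M)
    {x : ℝ} (hx : x ∈ Set.Ioo (-1 : ℝ) 1) : (pencil M x).PosDef := by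
  obtain ⟨hx0, hx1⟩ := hx
  have hp := (isQCov_iff_pencil M).mp hM
  have hn := pencil_neg_one hM
  have ha : 0 < (1 + x) / 2 := by linarith
  have hb : 0 < (1 - x) / 2 := by linarith
  have hsum : pencil M x = ((1 + x) / 2) • pencil M 1 + ((1 - x) / 2) • pencil M (-1) := by
    ext i j
    simp [pencil]
    ring
  have hps := hp.smul ha.le
  have hns := hn.smul hb.le
  rw [hsum]
  refine Matrix.PosDef.of_dotProduct_mulVec_pos (hps.add hns).isHermitian fun v hv => ?_
  refine lt_of_le_of_ne ((hps.add hns).dotProduct_mulVec_nonneg v) fun h0 => hv ?_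
  rw [Matrix.add_mulVec, dotProduct_add] at h0
  have e1 := hps.dotProduct_mulVec_nonneg v
  have e2 := hns.dotProduct_mulVec_nonneg v
  obtain ⟨z1, z2⟩ := (add_eq_zero_iff_of_nonneg e1 e2).mp h0.symm
  rw [hps.dotProduct_mulVec_zero_iff, Matrix.smul_mulVec, smul_eq_zero] at z1
  rw [hns.dotProduct_mulVec_zero_iff, Matrix.smul_mulVec, smul_eq_zero] at z2
  have k1 := z1.resolve_left ha.ne'
  have k2 := z2.resolve_left hb.ne'
  have hJ : (Jmat d).map Complex.ofReal = (-Complex.I / 2) • (pencil M 1 - pencil M (-1)) := by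
    ext i j
    simp [pencil]
    linear_combination (Jmat d i j : ℂ) * Complex.I_mul_I
  have hJv : (Jmat d).map Complex.ofReal *ᵥ v = 0 := by
    rw [hJ, Matrix.smul_mulVec, Matrix.sub_mulVec, k1, k2, sub_zero, smul_zero]
  have h3 : ((Jmat d).map Complex.ofReal * (Jmat d).map Complex.ofReal) *ᵥ v = 0 := by
    rw [← Matrix.mulVec_mulVec, hJv, Matrix.mulVec_zero]
  rw [Jmat_map_mul_self hd] at h3
  simpa [Matrix.neg_mulVec] using h3

theorem IsQCov.posDef {d : ℕ} (hd : Even d) {M : Matrix (Fin d) (Fin d) ℝ} (hM : IsQCov M) :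
    M.PosDef := by
  have h := pencil_posDef hd hM (x := 0) (by norm_num)
  rw [pencil_zero] at h
  refine Matrix.PosDef.of_dotProduct_mulVec_pos
    (by rw [Matrix.IsHermitian, Matrix.conjTranspose_eq_transpose_of_trivial]; exact hM.1)
    fun v hv => ?_
  have hv' : (Complex.ofReal ∘ v) ≠ 0 := fun h0 => hv <| by
    ext i
    simpa using congrFun h0 i
  have h1 := h.dotProduct_mulVec_pos hv'
  have h2 : star (Complex.ofReal ∘ v) ⬝ᵥ M.map Complex.ofReal *ᵥ (Complex.ofReal ∘ v)
      = ((star v ⬝ᵥ M *ᵥ v : ℝ) : ℂ) := by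
    simp [dotProduct, Matrix.mulVec]
  rw [h2] at h1
  exact_mod_cast h1

theorem GFn_abs_eq_integral (μ : ℝ) :
    GFn |μ| = (∫ x in (-1 : ℝ)..1, Real.log (x - μ)) / 2 + (1 - Real.log 2) := by
  have key : ∀ y : ℝ, y * Real.log (y / 2) = y * Real.log y - y * Real.log 2 := by
    intro y
    rcases eq_or_ne y 0 with rfl | hy
    · simp
    · rw [Real.log_div hy two_ne_zero]
      ring
  have h1 : ∫ x in (-1 : ℝ)..1, Real.log (x - μ) =
      (1 - μ) * Real.log (1 - μ) + (1 + μ) * Real.log (1 + μ) - 2 := by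
    rw [intervalIntegral.integral_comp_sub_right (fun x => Real.log x), integral_log,
      ← Real.log_neg_eq_log (-1 - μ)]
    ring_nf
  have h2 : ∀ y : ℝ, GFn y =
      ((1 + y) * Real.log (1 + y) + (1 - y) * Real.log (1 - y)) / 2 - Real.log 2 := by
    intro y
    have k1 := key (y + 1)
    have k2 := key (y - 1)
    rw [GFn, gFn, show (y - 1) / 2 + 1 = (y + 1) / 2 by ring]
    rw [← neg_sub y 1, Real.log_neg_eq_log, add_comm 1 y]
    linarith
  rw [h1, h2]
  rcases abs_choice μ with h | h <;> rw [h] <;> ring_nf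

theorem intervalIntegrable_log_sub (μ a b : ℝ) :
    IntervalIntegrable (fun x => Real.log (x - μ)) MeasureTheory.volume a b := by
  simpa using (intervalIntegral.intervalIntegrable_log' (a := a - μ) (b := b - μ)).comp_sub_right μ

theorem exists_eigenvalues_pencil {d : ℕ} (hd : Even d) {M : Matrix (Fin d) (Fin d) ℝ}
    (hM : IsQCov M) :
    ∃ ν : Fin d → ℝ, Ent M = (∑ i, GFn |ν i|) / 2 ∧
      ∀ x : ℝ, ‖(pencil M x).det‖ = ‖∏ i, (x - ν i)‖ := by
  have hP := pencil_posDef hd hM (x := 0) (by norm_num)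
  rw [pencil_zero] at hP
  obtain ⟨C, hC⟩ : ∃ C : Matrix (Fin d) (Fin d) ℂ, M.map Complex.ofReal = Cᴴ * C := by
    open scoped MatrixOrder in
    exact CStarAlgebra.nonneg_iff_eq_star_mul_self.mp hP.posSemidef.nonneg
  set J : Matrix (Fin d) (Fin d) ℂ := (Jmat d).map Complex.ofReal with hJ
  set H : Matrix (Fin d) (Fin d) ℂ := C * (Complex.I • J) * Cᴴ with hHdef
  have hH : H.IsHermitian := by
    apply Matrix.isHermitian_mul_mul_conjTranspose
    rw [Matrix.IsHermitian, Matrix.conjTranspose_smul, hJ, Jmat_map_conjTranspose]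
    simp
  have hmul : Complex.I • (Jmat d * M).map Complex.ofReal = (Complex.I • J) * (Cᴴ * C) := by
    rw [← hC, Matrix.smul_mul]
    congr 1
    exact Matrix.map_mul (f := Complex.ofRealHom)
  have hchar : (Complex.I • (Jmat d * M).map Complex.ofReal).charpoly = H.charpoly := by
    rw [hmul, hHdef, ← Matrix.mul_assoc, Matrix.charpoly_mul_comm, Matrix.mul_assoc]
  refine ⟨fun i => -hH.eigenvalues i, ?_, fun x => ?_⟩
  · rw [Ent, hchar, hH.roots_charpoly_eq_eigenvalues, Multiset.map_map]
    simp [Finset.sum]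
  · have h1 : (Complex.I • (Jmat d * M).map Complex.ofReal).charpoly.eval (-x : ℂ) =
        ((∏ i, (-x - hH.eigenvalues i) : ℝ) : ℂ) := by
      rw [hchar, hH.charpoly_eq, Polynomial.eval_prod]
      simp
    have h2 : Matrix.scalar (Fin d) (-x : ℂ) - Complex.I • (Jmat d * M).map Complex.ofReal =
        -((Complex.I • J) * pencil M x) := by
      rw [hmul, ← hC, pencil, Matrix.mul_add, ← hJ, Matrix.smul_mul _ J (_ • J), Matrix.mul_smul,
        hJ, Jmat_map_mul_self hd, smul_smul]
      ext i j
      by_cases hij : i = j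
      · subst hij
        simp
        linear_combination -(x : ℂ) * Complex.I_mul_I
      · simp [hij]
    rw [Matrix.eval_charpoly, h2, Matrix.det_neg, Matrix.det_mul] at h1
    have h3 := congrArg norm h1
    rw [norm_mul, norm_mul, norm_det_I_smul_Jmat hd] at h3
    simp only [norm_pow, norm_neg, norm_one, one_pow, one_mul, Complex.norm_real] at h3
    rw [h3, norm_prod, norm_prod]
    refine Finset.prod_congr rfl fun i _ => ?_
    rw [← norm_neg, neg_sub, sub_neg_eq_add, sub_neg_eq_add, add_comm]

theorem log_norm_prod_sub {ι : Type*} [Fintype ι] (ν : ι → ℝ) {x : ℝ}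
    (h : ∏ i, (x - ν i) ≠ 0) :
    Real.log ‖∏ i, (x - ν i)‖ = ∑ i, Real.log (x - ν i) := by
  rw [Real.norm_eq_abs, Real.log_abs, Real.log_prod fun i _ => ?_]
  exact Finset.prod_ne_zero_iff.mp h i (Finset.mem_univ i)

/-- The entropy of a quantum covariance matrix as an integral of `log det (M + i·x·J)`. -/
theorem ent_eq_integral {d : ℕ} (hd : Even d) {M : Matrix (Fin d) (Fin d) ℝ} (hM : IsQCov M) :
    IntervalIntegrable (fun x => Real.log ‖(pencil M x).det‖) MeasureTheory.volume (-1) 1 ∧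
    Ent M = (∫ x in (-1 : ℝ)..1, Real.log ‖(pencil M x).det‖) / 4 +
      d / 2 * (1 - Real.log 2) := by
  obtain ⟨ν, hE, hdet⟩ := exists_eigenvalues_pencil hd hM
  have hcongr : Set.EqOn (fun x => ∑ i, Real.log (x - ν i))
      (fun x => Real.log ‖(pencil M x).det‖) (Set.Ioo (-1) 1) := by
    intro x hx
    simp only
    rw [hdet, log_norm_prod_sub]
    rw [← norm_ne_zero_iff, ← hdet]
    exact norm_ne_zero_iff.mpr (pencil_posDef hd hM hx).det_pos.ne'
  have hint : IntervalIntegrable (fun x => ∑ i, Real.log (x - ν i))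
      MeasureTheory.volume (-1) 1 := by
    simpa only [Finset.sum_fn] using IntervalIntegrable.sum Finset.univ
      (fun i _ => intervalIntegrable_log_sub (ν i) (-1) 1)
  have hI : ∫ x in (-1 : ℝ)..1, Real.log ‖(pencil M x).det‖ =
      ∑ i, ∫ x in (-1 : ℝ)..1, Real.log (x - ν i) := by
    rw [← intervalIntegral.integral_finsetSum fun i _ => intervalIntegrable_log_sub (ν i) (-1) 1]
    exact (intervalIntegral.integral_congr_Ioo_of_le (by norm_num) hcongr).symm
  refine ⟨hint.congr_uIoo (by rwa [Set.uIoo_of_le (by norm_num)]), ?_⟩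
  · rw [hE, hI]
    simp only [GFn_abs_eq_integral, Finset.sum_add_distrib, ← Finset.sum_div]
    simp
    ring

theorem log_det_le_trace_sub {ι : Type*} [Fintype ι] [DecidableEq ι] {X : Matrix ι ι ℂ}
    (hX : X.PosDef) : Real.log ‖X.det‖ ≤ X.trace.re - Fintype.card ι := by
  rw [hX.isHermitian.det_eq_prod_eigenvalues, hX.isHermitian.trace_eq_sum_eigenvalues, norm_prod,
    Real.log_prod (fun i _ => ?_)]
  swap
  · exact norm_ne_zero_iff.mpr (Complex.ofReal_ne_zero.mpr (hX.eigenvalues_pos i).ne')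
  have h : ∀ i, Real.log ‖((hX.isHermitian.eigenvalues i : ℝ) : ℂ)‖ ≤
      hX.isHermitian.eigenvalues i - 1 := fun i => by
    rw [Complex.norm_of_nonneg (hX.eigenvalues_pos i).le]
    exact Real.log_le_sub_one_of_pos (hX.eigenvalues_pos i)
  simpa using Finset.sum_le_sum fun i (_ : i ∈ Finset.univ) => h i

theorem log_det_sub_log_det_le {ι : Type*} [Fintype ι] [DecidableEq ι] {P R : Matrix ι ι ℂ}
    (hP : P.PosDef) (hR : R.PosDef) :
    Real.log ‖P.det‖ - Real.log ‖R.det‖ ≤ (P * R⁻¹).trace.re - Fintype.card ι := by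
  obtain ⟨C, hC⟩ : ∃ C : Matrix ι ι ℂ, R⁻¹ = C * Cᴴ := by
    open scoped MatrixOrder in
    exact CStarAlgebra.nonneg_iff_eq_mul_star_self.mp hR.inv.posSemidef.nonneg
  have hCu : IsUnit C := by
    rw [Matrix.isUnit_iff_isUnit_det]
    have h := hR.inv.det_pos.ne'
    rw [hC, Matrix.det_mul] at h
    exact (left_ne_zero_of_mul h).isUnit
  have h := log_det_le_trace_sub
    (hP.conjTranspose_mul_mul_same (Matrix.mulVec_injective_of_isUnit hCu))
  have hdet : (Cᴴ * P * C).det = P.det * (R.det)⁻¹ := by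
    rw [← Ring.inverse_eq_inv', ← Matrix.det_nonsing_inv, hC]
    simp only [Matrix.det_mul]
    ring
  rw [Matrix.trace_mul_comm, ← Matrix.mul_assoc, ← hC, Matrix.trace_mul_comm, hdet, norm_mul,
    norm_inv, Real.log_mul (norm_ne_zero_iff.mpr hP.det_pos.ne')
      (inv_ne_zero (norm_ne_zero_iff.mpr hR.det_pos.ne')), Real.log_inv] at h
  linarith

/-- Concavity of `log det` on positive definite matrices. -/
theorem log_det_concave {ι : Type*} [Fintype ι] [DecidableEq ι] {P Q : Matrix ι ι ℂ}
    (hP : P.PosDef) (hQ : Q.PosDef) {t : ℝ} (ht0 : 0 ≤ t) (ht1 : t ≤ 1) :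
    t * Real.log ‖P.det‖ + (1 - t) * Real.log ‖Q.det‖ ≤
      Real.log ‖(t • P + (1 - t) • Q).det‖ := by
  have hR : (t • P + (1 - t) • Q).PosDef := by
    rcases ht0.eq_or_lt with rfl | h0
    · simpa using hQ
    · exact (hP.smul h0).add_posSemidef (hQ.posSemidef.smul (by linarith))
  set R := t • P + (1 - t) • Q with hRdef
  have h1 := mul_le_mul_of_nonneg_left (log_det_sub_log_det_le hP hR) ht0
  have h2 := mul_le_mul_of_nonneg_left (log_det_sub_log_det_le hQ hR) (sub_nonneg.mpr ht1)
  have h3 : t * (P * R⁻¹).trace.re + (1 - t) * (Q * R⁻¹).trace.re = Fintype.card ι := by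
    have h4 : (R * R⁻¹).trace = Fintype.card ι := by
      rw [Matrix.mul_nonsing_inv _ hR.det_pos.ne'.isUnit, Matrix.trace_one]
    have h5 : (R * R⁻¹).trace = t * (P * R⁻¹).trace + (1 - t) * (Q * R⁻¹).trace := by
      conv_lhs => rw [hRdef]
      rw [← hRdef, Matrix.add_mul, Matrix.trace_add, Matrix.smul_mul, Matrix.smul_mul,
        Matrix.trace_smul, Matrix.trace_smul]
      simp
    have h6 := congrArg Complex.re (h5.symm.trans h4)
    simpa using h6
  linarith

/-- The Schur complement of a positive definite block matrix is positive definite. -/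
theorem schur_posDef {ι κ : Type*} [Fintype ι] [Fintype κ] [DecidableEq ι] [DecidableEq κ]
    {A : Matrix ι ι ℂ} {K : Matrix ι κ ℂ} {B : Matrix κ κ ℂ}
    (h : (Matrix.fromBlocks A K Kᴴ B).PosDef) :
    B.PosDef ∧ (A - K * B⁻¹ * Kᴴ).PosDef ∧
      Real.log ‖(Matrix.fromBlocks A K Kᴴ B).det‖ =
        Real.log ‖B.det‖ + Real.log ‖(A - K * B⁻¹ * Kᴴ).det‖ := by
  have hB : B.PosDef := h.submatrix (e := Sum.inr) Sum.inr_injective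
  let : Invertible B := hB.isUnit.invertible
  have hdet : (Matrix.fromBlocks A K Kᴴ B).det = B.det * (A - K * B⁻¹ * Kᴴ).det := by
    rw [Matrix.det_fromBlocks₂₂, Matrix.invOf_eq_nonsing_inv]
  have h0 := h.det_pos.ne'
  rw [hdet] at h0
  refine ⟨hB, ?_, ?_⟩
  · exact ((hB.fromBlocks₂₂ A K).mp h.posSemidef).posDef_iff_det_ne_zero.mpr
      (right_ne_zero_of_mul h0)
  · rw [hdet, norm_mul, Real.log_mul (norm_ne_zero_iff.mpr (left_ne_zero_of_mul h0))
      (norm_ne_zero_iff.mpr (right_ne_zero_of_mul h0))]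

theorem fromBlocks_diagonal_inv {κ κ' : Type*} [Fintype κ] [Fintype κ'] [DecidableEq κ]
    [DecidableEq κ'] {B : Matrix κ κ ℂ} {B' : Matrix κ' κ' ℂ} (hB : B.PosDef) (hB' : B'.PosDef) :
    (Matrix.fromBlocks B 0 0 B')⁻¹ = Matrix.fromBlocks B⁻¹ 0 0 B'⁻¹ := by
  apply Matrix.inv_eq_right_inv
  simp [Matrix.fromBlocks_multiply, Matrix.mul_nonsing_inv _ hB.det_pos.ne'.isUnit,
    Matrix.mul_nonsing_inv _ hB'.det_pos.ne'.isUnit]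

/-- The three-party block matrix obtained by mixing the first components of two bipartite ones. -/
def mixBlocks {ι κ κ' : Type*} (t : ℝ) (A₁ : Matrix ι ι ℂ) (K₁ : Matrix ι κ ℂ) (B₁ : Matrix κ κ ℂ)
    (A₂ : Matrix ι ι ℂ) (K₂ : Matrix ι κ' ℂ) (B₂ : Matrix κ' κ' ℂ) :
    Matrix (ι ⊕ (κ ⊕ κ')) (ι ⊕ (κ ⊕ κ')) ℂ :=
  Matrix.fromBlocks (t • A₁ + (1 - t) • A₂)
    (Matrix.fromCols (√t • K₁) (√(1 - t) • K₂))
    (Matrix.fromCols (√t • K₁) (√(1 - t) • K₂))ᴴ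
    (Matrix.fromBlocks B₁ 0 0 B₂)

theorem mixBlocks_posSemidef {ι κ κ' : Type*} [Fintype ι] [Fintype κ] [Fintype κ']
    [DecidableEq ι] [DecidableEq κ] [DecidableEq κ'] {t : ℝ} (ht0 : 0 ≤ t) (ht1 : t ≤ 1)
    {A₁ : Matrix ι ι ℂ} {K₁ : Matrix ι κ ℂ} {B₁ : Matrix κ κ ℂ}
    {A₂ : Matrix ι ι ℂ} {K₂ : Matrix ι κ' ℂ} {B₂ : Matrix κ' κ' ℂ}
    (h₁ : (Matrix.fromBlocks A₁ K₁ K₁ᴴ B₁).PosSemidef)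
    (h₂ : (Matrix.fromBlocks A₂ K₂ K₂ᴴ B₂).PosSemidef) :
    (mixBlocks t A₁ K₁ B₁ A₂ K₂ B₂).PosSemidef := by
  let T₁ : Matrix (ι ⊕ κ) (ι ⊕ (κ ⊕ κ')) ℂ :=
    Matrix.fromBlocks (√t • 1) 0 0 (Matrix.fromCols 1 0)
  let T₂ : Matrix (ι ⊕ κ') (ι ⊕ (κ ⊕ κ')) ℂ :=
    Matrix.fromBlocks (√(1 - t) • 1) 0 0 (Matrix.fromCols 0 1)
  have e : mixBlocks t A₁ K₁ B₁ A₂ K₂ B₂ =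
      T₁ᴴ * Matrix.fromBlocks A₁ K₁ K₁ᴴ B₁ * T₁ + T₂ᴴ * Matrix.fromBlocks A₂ K₂ K₂ᴴ B₂ * T₂ := by
    have s1 : √t * √t = t := Real.mul_self_sqrt ht0
    have s2 : √(1 - t) * √(1 - t) = 1 - t := Real.mul_self_sqrt (by linarith)
    simp only [mixBlocks, T₁, T₂, Matrix.fromBlocks_conjTranspose, Matrix.fromBlocks_multiply,
      Matrix.fromBlocks_add, Matrix.conjTranspose_fromCols_eq_fromRows_conjTranspose,
      Matrix.fromRows_mul, Matrix.mul_fromCols, Matrix.conjTranspose_smul,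
      Matrix.conjTranspose_one, Matrix.conjTranspose_zero, Matrix.smul_mul, Matrix.mul_smul,
      Matrix.zero_mul, Matrix.mul_zero, Matrix.one_mul, Matrix.mul_one, add_zero, zero_add,
      smul_smul, star_trivial, s1, s2]
    congr 1
    · ext i (j | j) <;> simp
    · ext (i | i) j <;> simp
    · ext (i | i) (j | j) <;> simp
  rw [e]
  exact (h₁.conjTranspose_mul_mul_same T₁).add (h₂.conjTranspose_mul_mul_same T₂)

theorem mixBlocks_log_det {ι κ κ' : Type*} [Fintype ι] [Fintype κ] [Fintype κ']
    [DecidableEq ι] [DecidableEq κ] [DecidableEq κ'] {t : ℝ} (ht0 : 0 ≤ t) (ht1 : t ≤ 1)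
    {A₁ : Matrix ι ι ℂ} {K₁ : Matrix ι κ ℂ} {B₁ : Matrix κ κ ℂ}
    {A₂ : Matrix ι ι ℂ} {K₂ : Matrix ι κ' ℂ} {B₂ : Matrix κ' κ' ℂ}
    (h₁ : (Matrix.fromBlocks A₁ K₁ K₁ᴴ B₁).PosDef)
    (h₂ : (Matrix.fromBlocks A₂ K₂ K₂ᴴ B₂).PosDef)
    (h : (mixBlocks t A₁ K₁ B₁ A₂ K₂ B₂).PosDef) :
    t * (Real.log ‖(Matrix.fromBlocks A₁ K₁ K₁ᴴ B₁).det‖ - Real.log ‖B₁.det‖) +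
      (1 - t) * (Real.log ‖(Matrix.fromBlocks A₂ K₂ K₂ᴴ B₂).det‖ - Real.log ‖B₂.det‖) ≤
    Real.log ‖(mixBlocks t A₁ K₁ B₁ A₂ K₂ B₂).det‖ - Real.log ‖B₁.det‖ - Real.log ‖B₂.det‖ := by
  obtain ⟨hB₁, hS₁, e₁⟩ := schur_posDef h₁
  obtain ⟨hB₂, hS₂, e₂⟩ := schur_posDef h₂
  obtain ⟨-, -, e⟩ := schur_posDef h
  have hS : t • A₁ + (1 - t) • A₂ - Matrix.fromCols (√t • K₁) (√(1 - t) • K₂) *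
      (Matrix.fromBlocks B₁ 0 0 B₂)⁻¹ * (Matrix.fromCols (√t • K₁) (√(1 - t) • K₂))ᴴ =
      t • (A₁ - K₁ * B₁⁻¹ * K₁ᴴ) + (1 - t) • (A₂ - K₂ * B₂⁻¹ * K₂ᴴ) := by
    have s1 : √t * √t = t := Real.mul_self_sqrt ht0
    have s2 : √(1 - t) * √(1 - t) = 1 - t := Real.mul_self_sqrt (by linarith)
    rw [fromBlocks_diagonal_inv hB₁ hB₂, Matrix.fromCols_mul_fromBlocks,
      Matrix.conjTranspose_fromCols_eq_fromRows_conjTranspose, Matrix.fromCols_mul_fromRows]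
    simp only [Matrix.conjTranspose_smul, Matrix.smul_mul, Matrix.mul_smul, Matrix.mul_zero,
      add_zero, zero_add, smul_smul, star_trivial, s1, s2, smul_sub]
    abel
  have hc := log_det_concave hS₁ hS₂ ht0 ht1
  rw [mixBlocks, e, hS, Matrix.det_fromBlocks_zero₂₁, norm_mul,
    Real.log_mul (norm_ne_zero_iff.mpr hB₁.det_pos.ne') (norm_ne_zero_iff.mpr hB₂.det_pos.ne'),
    e₁, e₂]
  linarith

theorem Jmat_castAdd_castAdd {a b : ℕ} (i j : Fin a) :
    Jmat (a + b) (Fin.castAdd b i) (Fin.castAdd b j) = Jmat a i j := by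
  simp [Jmat]

theorem Jmat_natAdd_natAdd {a b : ℕ} (ha : Even a) (i j : Fin b) :
    Jmat (a + b) (Fin.natAdd a i) (Fin.natAdd a j) = Jmat b i j := by
  have h := Nat.even_iff.mp ha
  have h1 : (a + (i : ℕ)) % 2 = (i : ℕ) % 2 := by omega
  have h2 : (a + (j : ℕ)) % 2 = (j : ℕ) % 2 := by omega
  simp [Jmat, h1, h2, add_assoc]

theorem Jmat_castAdd_natAdd {a b : ℕ} (ha : Even a) (i : Fin a) (j : Fin b) :
    Jmat (a + b) (Fin.castAdd b i) (Fin.natAdd a j) = 0 := by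
  have h := Nat.even_iff.mp ha
  have hi := i.isLt
  simp only [Jmat, Fin.val_castAdd, Fin.val_natAdd]
  rw [if_neg (by omega), if_neg (by omega)]

theorem Jmat_natAdd_castAdd {a b : ℕ} (ha : Even a) (i : Fin b) (j : Fin a) :
    Jmat (a + b) (Fin.natAdd a i) (Fin.castAdd b j) = 0 := by
  have h := Nat.even_iff.mp ha
  have hj := j.isLt
  simp only [Jmat, Fin.val_castAdd, Fin.val_natAdd]
  rw [if_neg (by omega), if_neg (by omega)]

theorem pencil_assemble2 {a b : ℕ} (ha : Even a) (A : Matrix (Fin a) (Fin a) ℝ)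
    (K : Matrix (Fin a) (Fin b) ℝ) (B : Matrix (Fin b) (Fin b) ℝ) (x : ℝ) :
    (pencil (assemble2 A K B) x).submatrix finSumFinEquiv finSumFinEquiv =
      Matrix.fromBlocks (pencil A x) (K.map Complex.ofReal) (K.map Complex.ofReal)ᴴ
        (pencil B x) := by
  ext (i | i) (j | j)
  · simp [pencil, assemble2, Jmat_castAdd_castAdd]
  · simp [pencil, assemble2, Jmat_castAdd_natAdd ha]
  · simp [pencil, assemble2, Jmat_natAdd_castAdd ha]
  · simp [pencil, assemble2, Jmat_natAdd_natAdd ha]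

/-- The equivalence splitting `Fin (a + b + c)` into three consecutive blocks. -/
def finSumThreeEquiv (a b c : ℕ) : Fin a ⊕ (Fin b ⊕ Fin c) ≃ Fin (a + b + c) :=
  (Equiv.sumAssoc _ _ _).symm.trans
    ((finSumFinEquiv.sumCongr (Equiv.refl _)).trans finSumFinEquiv)

theorem pencil_assemble3 {a b c : ℕ} (ha : Even a) (hb : Even b) (t x : ℝ)
    (A₁ A₂ : Matrix (Fin a) (Fin a) ℝ) (K₁ : Matrix (Fin a) (Fin b) ℝ)
    (K₂ : Matrix (Fin a) (Fin c) ℝ) (B₁ : Matrix (Fin b) (Fin b) ℝ)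
    (B₂ : Matrix (Fin c) (Fin c) ℝ) :
    (pencil (assemble3 (t • A₁ + (1 - t) • A₂) (√t • K₁) (√(1 - t) • K₂) B₁ B₂) x).submatrix
        (finSumThreeEquiv a b c) (finSumThreeEquiv a b c) =
      mixBlocks t (pencil A₁ x) (K₁.map Complex.ofReal) (pencil B₁ x)
        (pencil A₂ x) (K₂.map Complex.ofReal) (pencil B₂ x) := by
  have hn : ∀ k : ℕ, ¬ a + b + k < a := fun k => by omega
  have hs : ∀ k : ℕ, a + b + k - a - b = k := fun k => by omega
  ext (i | i | i) (j | j | j)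
  · simp [finSumThreeEquiv, mixBlocks, pencil, assemble3, Jmat_castAdd_castAdd]
    ring
  all_goals
    simp [finSumThreeEquiv, mixBlocks, pencil, assemble3, Jmat_castAdd_castAdd,
      Jmat_castAdd_natAdd ha, Jmat_natAdd_castAdd ha, Jmat_natAdd_natAdd ha,
      Jmat_castAdd_natAdd (ha.add hb), Jmat_natAdd_castAdd (ha.add hb),
      Jmat_natAdd_natAdd (ha.add hb), hn, hs]

theorem isQCov_assemble2_right {a b : ℕ} (ha : Even a) {A : Matrix (Fin a) (Fin a) ℝ}
    {K : Matrix (Fin a) (Fin b) ℝ} {B : Matrix (Fin b) (Fin b) ℝ}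
    (h : IsQCov (assemble2 A K B)) : IsQCov B := by
  rw [isQCov_iff_pencil, ← Matrix.posSemidef_submatrix_equiv finSumFinEquiv,
    pencil_assemble2 ha] at h
  exact (isQCov_iff_pencil B).mpr (h.submatrix Sum.inr)

/-- Conditional entropy power inequality for Gaussian states (Theorem 6.1). -/
theorem conditional_epi_gaussian (n L₁ L₂ : ℕ) (hn : 1 ≤ n) (hL₁ : 1 ≤ L₁) (hL₂ : 1 ≤ L₂)
    (lam : ℝ) (hlam0 : 0 ≤ lam) (hlam1 : lam ≤ 1)
    (A₁ : Matrix (Fin (2 * n)) (Fin (2 * n)) ℝ) (K₁ : Matrix (Fin (2 * n)) (Fin (2 * L₁)) ℝ)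
    (B₁ : Matrix (Fin (2 * L₁)) (Fin (2 * L₁)) ℝ)
    (A₂ : Matrix (Fin (2 * n)) (Fin (2 * n)) ℝ) (K₂ : Matrix (Fin (2 * n)) (Fin (2 * L₂)) ℝ)
    (B₂ : Matrix (Fin (2 * L₂)) (Fin (2 * L₂)) ℝ)
    (hM₁ : IsQCov (assemble2 A₁ K₁ B₁)) (hM₂ : IsQCov (assemble2 A₂ K₂ B₂)) :
    IsQCov (assemble3 (lam • A₁ + (1 - lam) • A₂)
        (Real.sqrt lam • K₁) (Real.sqrt (1 - lam) • K₂) B₁ B₂) ∧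
    (assemble3 (lam • A₁ + (1 - lam) • A₂)
        (Real.sqrt lam • K₁) (Real.sqrt (1 - lam) • K₂) B₁ B₂).PosDef ∧
    Ent (assemble3 (lam • A₁ + (1 - lam) • A₂)
        (Real.sqrt lam • K₁) (Real.sqrt (1 - lam) • K₂) B₁ B₂) - Ent B₁ - Ent B₂ ≥
      lam * (Ent (assemble2 A₁ K₁ B₁) - Ent B₁) +
        (1 - lam) * (Ent (assemble2 A₂ K₂ B₂) - Ent B₂) := by
  have hn2 : Even (2 * n) := even_two_mul n
  have hL₁2 : Even (2 * L₁) := even_two_mul L₁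
  have hL₂2 : Even (2 * L₂) := even_two_mul L₂
  set M := assemble3 (lam • A₁ + (1 - lam) • A₂) (√lam • K₁) (√(1 - lam) • K₂) B₁ B₂
  have hQ : IsQCov M := by
    rw [isQCov_iff_pencil, ← Matrix.posSemidef_submatrix_equiv finSumFinEquiv,
      pencil_assemble2 hn2] at hM₁ hM₂
    rw [isQCov_iff_pencil, ← Matrix.posSemidef_submatrix_equiv (finSumThreeEquiv _ _ _),
      pencil_assemble3 hn2 hL₁2]
    exact mixBlocks_posSemidef hlam0 hlam1 hM₁ hM₂
  have hd : Even (2 * n + 2 * L₁ + 2 * L₂) := (hn2.add hL₁2).add hL₂2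
  refine ⟨hQ, hQ.posDef hd, ?_⟩
  have hB₁ := isQCov_assemble2_right hn2 hM₁
  have hB₂ := isQCov_assemble2_right hn2 hM₂
  obtain ⟨i, e⟩ := ent_eq_integral hd hQ
  obtain ⟨i₁, e₁⟩ := ent_eq_integral (hn2.add hL₁2) hM₁
  obtain ⟨i₂, e₂⟩ := ent_eq_integral (hn2.add hL₂2) hM₂
  obtain ⟨j₁, f₁⟩ := ent_eq_integral hL₁2 hB₁
  obtain ⟨j₂, f₂⟩ := ent_eq_integral hL₂2 hB₂
  have key := intervalIntegral.integral_mono_on_of_le_Ioo (a := -1) (b := 1) (by norm_num)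
    (((i₁.sub j₁).const_mul lam).add ((i₂.sub j₂).const_mul (1 - lam))) ((i.sub j₁).sub j₂)
    fun x hx => by
      have p₁ := pencil_posDef (hn2.add hL₁2) hM₁ hx
      have p₂ := pencil_posDef (hn2.add hL₂2) hM₂ hx
      have p := pencil_posDef hd hQ hx
      replace p₁ := p₁.submatrix (e := finSumFinEquiv) finSumFinEquiv.injective
      replace p₂ := p₂.submatrix (e := finSumFinEquiv) finSumFinEquiv.injective
      replace p := p.submatrix (e := finSumThreeEquiv _ _ _) (finSumThreeEquiv _ _ _).injective
      rw [pencil_assemble2 hn2] at p₁ p₂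
      rw [pencil_assemble3 hn2 hL₁2] at p
      have h := mixBlocks_log_det hlam0 hlam1 p₁ p₂ p
      rwa [← pencil_assemble2 hn2, ← pencil_assemble2 hn2, ← pencil_assemble3 hn2 hL₁2,
        Matrix.det_submatrix_equiv_self, Matrix.det_submatrix_equiv_self,
        Matrix.det_submatrix_equiv_self] at h
  rw [intervalIntegral.integral_add ((i₁.sub j₁).const_mul lam)
      ((i₂.sub j₂).const_mul (1 - lam)), intervalIntegral.integral_const_mul,
    intervalIntegral.integral_const_mul, intervalIntegral.integral_sub i₁ j₁,
    intervalIntegral.integral_sub i₂ j₂, intervalIntegral.integral_sub (i.sub j₁) j₂,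
    intervalIntegral.integral_sub i j₁] at key
  rw [e, e₁, e₂, f₁, f₂]
  push_cast
  linarith

end
end

section
/- Taylor estimate for the single-mode entropy function: For every λ > 1 and every ε ≥ 0, |G(λ+ε) − G(λ)| ≤ ε·β(λ)/2 + ε²/(2·(λ²−1)). -/
open scoped Classical ComplexOrder

noncomputable section

/-- The graph of `gFn` on the positive reals lies below each of its tangent lines. -/
theorem gFn_sub_le {x y : ℝ} (hx : 0 < x) (hy : 0 < y) :
    gFn y - gFn x ≤ (y - x) * Real.log ((x + 1) / x) := by
  have hx1 : 0 < x + 1 := by linarith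
  have hy1 : 0 < y + 1 := by linarith
  have h1 := Real.log_le_sub_one_of_pos (div_pos (mul_pos hx hy1) (mul_pos hy hx1))
  have h2 := Real.log_le_sub_one_of_pos (div_pos hy1 hx1)
  have h3 := mul_le_mul_of_nonneg_left h1 hy.le
  have h4 : y * (x * (y + 1) / (y * (x + 1)) - 1) + ((y + 1) / (x + 1) - 1) = 0 := by
    field_simp
    ring
  rw [Real.log_div (by positivity) (by positivity), Real.log_mul hx.ne' hy1.ne',
    Real.log_mul hy.ne' hx1.ne'] at h3
  rw [Real.log_div hy1.ne' hx1.ne'] at h2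
  rw [Real.log_div hx1.ne' hx.ne', gFn, gFn]
  linarith

/-- The function `gFn` is monotone on the positive reals. -/
theorem gFn_le_gFn {x y : ℝ} (hx : 0 < x) (hxy : x ≤ y) : gFn x ≤ gFn y := by
  have hy : 0 < y := hx.trans_le hxy
  have hlog : 0 ≤ Real.log ((y + 1) / y) :=
    Real.log_nonneg ((one_le_div hy).2 (by linarith))
  nlinarith [gFn_sub_le hy hx, mul_nonneg (sub_nonneg.2 hxy) hlog]

/-- Taylor estimate for the single-mode entropy function. -/
theorem taylor_estimate_G (lam eps : ℝ) (hlam : 1 < lam) (heps : 0 ≤ eps) :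
    |GFn (lam + eps) - GFn lam| ≤ eps * betaFn lam / 2 + eps ^ 2 / (2 * (lam ^ 2 - 1)) := by
  have hx : 0 < (lam - 1) / 2 := by linarith
  have hxy : (lam - 1) / 2 ≤ (lam + eps - 1) / 2 := by linarith
  have hupper := gFn_sub_le hx (hx.trans_le hxy)
  have hmono := gFn_le_gFn hx hxy
  have hratio : ((lam - 1) / 2 + 1) / ((lam - 1) / 2) = (lam + 1) / (lam - 1) := by
    have : lam - 1 ≠ 0 := by linarith
    field_simp
    ring
  have hquad : 0 ≤ eps ^ 2 / (2 * (lam ^ 2 - 1)) :=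
    div_nonneg (sq_nonneg eps) (by nlinarith)
  rw [hratio] at hupper
  rw [GFn, GFn, abs_of_nonneg (sub_nonneg.2 hmono), betaFn]
  linarith

end
end
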